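/- arXiv:math/0209003 — 5 statements merged into one kernel-verified Lean document; each statement's English description precedes it below -/
import Mathlib

section
/- Let k be a commutative ring and B a k-algebra which is flat as a k-module. Let I be the kernel of the unit map algebraMap : k → B, regarded as a k-submodule of k. Then the tensor product I ⊗[k] B is the zero module (i.e. it is a subsingleton). -/
open TensorProduct

/-- For a commutative ring `k` and a `k`-algebra `B` that is flat as a `k`-module,
the tensor product of `I = ker(algebraMap k B)` with `B` over `k` is trivial. -/
theorem kernel_tensor_subsingleton (k B : Type*) [CommRing k] [Ring B] [Algebra k B]
    [Module.Flat k B] :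
    Subsingleton ((RingHom.ker (algebraMap k B) : Ideal k) ⊗[k] B) := by
  have hinj := Module.Flat.rTensor_preserves_injective_linearMap (M := B)
    (Submodule.subtype (RingHom.ker (algebraMap k B) : Ideal k)) Subtype.val_injective
  refine subsingleton_of_forall_eq 0 fun x => hinj ?_
  rw [map_zero]
  induction x with
  | zero => simp
  | add x y hx hy => rw [map_add, hx, hy, add_zero]
  | tmul i b =>
    apply (TensorProduct.lid k B).injective
    have hi : algebraMap k B (i : k) = 0 := i.2
    simp [Algebra.smul_def, hi]
end

section
/- Let R be a commutative ring and M a finitely generated projective R-module on which R acts faithfully. Then M is faithfully flat over R; in particular, for every R-module N, if N ⊗[R] M is trivial (a subsingleton) then N is trivial. -/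
open TensorProduct

/-- A finitely generated projective module with faithful scalar action over a commutative
ring is faithfully flat; in particular any module whose tensor product with it vanishes
is itself trivial. -/
theorem faithfullyFlat_of_fg_projective_faithful (R M : Type*) [CommRing R] [AddCommGroup M]
    [Module R M] [Module.Finite R M] [Module.Projective R M] [FaithfulSMul R M] :
    Module.FaithfullyFlat R M ∧
      ∀ (N : Type _) [AddCommGroup N] [Module R N],
        Subsingleton (N ⊗[R] M) → Subsingleton N := by
  have hff : Module.FaithfullyFlat R M := by
    refine { submodule_ne_top := ?_ }
    intro m hm htop
    obtain ⟨r, hr, hr0⟩ :=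
      Submodule.exists_sub_one_mem_and_smul_eq_zero_of_fg_of_le_smul m (⊤ : Submodule R M)
        Module.Finite.fg_top htop.ge
    have h0 : r = 0 := FaithfulSMul.eq_of_smul_eq_smul (α := M) fun a => by
      rw [zero_smul]
      exact hr0 a trivial
    rw [h0, zero_sub] at hr
    exact hm.ne_top ((Ideal.eq_top_iff_one m).2 (neg_mem_iff.1 hr))
  refine ⟨hff, ?_⟩
  intro N _ _ h
  exact Module.FaithfullyFlat.rTensor_reflects_triviality R M N
end

section
/- Let k be a field and regard k as a module over the polynomial ring k[Y] via evaluation of polynomials at 0. Then Ext^0_{k[Y]}(k, k) and Ext^1_{k[Y]}(k, k) are each isomorphic to k as abelian groups, and Ext^n_{k[Y]}(k, k) is trivial (a subsingleton) for every n ≥ 2. -/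
open CategoryTheory Polynomial

namespace ExtPolyAux

open Abelian

universe w u

variable {k : Type u} [Field k] [Module k[X] k]

/-- Multiplication by `X` followed by evaluation at `0`. -/
noncomputable def S (hm : ∀ (p : k[X]) (a : k), p • a = p.eval 0 * a) :
    ShortComplex (ModuleCat.{u} k[X]) :=
  ShortComplex.mk (X₁ := ModuleCat.of k[X] k[X]) (X₂ := ModuleCat.of k[X] k[X])
    (X₃ := ModuleCat.of k[X] k)
    (ModuleCat.ofHom (LinearMap.toSpanSingleton k[X] k[X] X))
    (ModuleCat.ofHom (LinearMap.toSpanSingleton k[X] k 1)) (by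
      ext
      simp [hm])

lemma S_exact (hm : ∀ (p : k[X]) (a : k), p • a = p.eval 0 * a) : (S hm).ShortExact where
  exact := by
    rw [ShortComplex.moduleCat_exact_iff]
    intro (p : k[X]) hp
    have hp' : p • (1 : k) = 0 := hp
    rw [hm, mul_one, ← coeff_zero_eq_eval_zero] at hp'
    obtain ⟨q, rfl⟩ := X_dvd_iff.2 hp'
    exact ⟨q, mul_comm q X⟩
  mono_f := by
    rw [ModuleCat.mono_iff_injective]
    intro (p : k[X]) (q : k[X]) h
    have h' : (HMul.hMul (α := k[X]) p X : k[X]) = HMul.hMul (α := k[X]) q X := h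
    exact (mul_left_injective₀ (X_ne_zero (R := k))) h'
  epi_g := by
    rw [ModuleCat.epi_iff_surjective]
    intro (a : k)
    refine ⟨(C a : k[X]), ?_⟩
    change (C a : k[X]) • (1 : k) = a
    simp [hm]

lemma proj : Projective (ModuleCat.of k[X] k[X]) :=
  (IsProjective.iff_projective (R := k[X]) k[X]).1 inferInstance

/-- Endomorphisms of `k`. -/
noncomputable def endEquiv (hm : ∀ (p : k[X]) (a : k), p • a = p.eval 0 * a) :
    (k →ₗ[k[X]] k) ≃+ k where
  toFun f := f 1
  invFun a :=
    { toFun := fun b => b * a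
      map_add' := fun b c => add_mul b c a
      map_smul' := fun p b => by simp [hm, mul_assoc] }
  left_inv f := by
    ext b
    have h := f.map_smul (C b) 1
    simp only [hm, eval_C, mul_one] at h
    exact h.symm
  right_inv a := one_mul a
  map_add' _ _ := rfl

/-- Maps from the free module. -/
noncomputable def freeEquiv : (k[X] →ₗ[k[X]] k) ≃+ k :=
  (LinearMap.ringLmapEquivSelf k[X] k[X] k).toAddEquiv

theorem main [HasExt.{w} (ModuleCat.{u} k[X])]
    (hm : ∀ (p : k[X]) (a : k), p • a = p.eval 0 * a) :
    Nonempty ((Ext (ModuleCat.of k[X] k) (ModuleCat.of k[X] k) 0) ≃+ k) ∧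
    Nonempty ((Ext (ModuleCat.of k[X] k) (ModuleCat.of k[X] k) 1) ≃+ k) ∧
    ∀ n : ℕ, 2 ≤ n → Subsingleton (Ext (ModuleCat.of k[X] k) (ModuleCat.of k[X] k) n) := by
  have hP : Projective (ModuleCat.of k[X] k[X]) := proj
  have hP₁ : Projective (S hm).X₁ := hP
  have hP₂ : Projective (S hm).X₂ := hP
  have hS := S_exact hm
  refine ⟨⟨Ext.addEquiv₀.trans (ModuleCat.homAddEquiv.trans (endEquiv hm))⟩, ?_, ?_⟩
  · have surj : Function.Surjective
        (Ext.precomp hS.extClass (ModuleCat.of k[X] k) (add_zero 1)) := fun x₃ ↦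
      Ext.contravariant_sequence_exact₃ hS _ x₃ (Ext.eq_zero_of_projective _) (add_zero 1)
    have inj : Function.Injective
        (Ext.precomp hS.extClass (ModuleCat.of k[X] k) (add_zero 1)) := by
      rw [injective_iff_map_eq_zero]
      intro x hx
      obtain ⟨y, rfl⟩ := Ext.contravariant_sequence_exact₁ hS _ x (add_zero 1) hx
      obtain ⟨g, rfl⟩ := Ext.addEquiv₀.symm.surjective y
      have h0 : (S hm).f ≫ g = 0 := by
        apply ModuleCat.hom_ext
        apply LinearMap.ext
        intro (p : k[X])
        change g.hom ((p * X : k[X]) : k[X]) = (0 : k)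
        have h1 : g.hom ((p * X) • (1 : k[X]) : k[X]) = (p * X) • (g.hom (1 : k[X]) : k) :=
          g.hom.map_smul (p * X) (1 : k[X])
        rw [smul_eq_mul, mul_one, hm] at h1
        rw [h1]
        simp
      change (Ext.mk₀ (S hm).f).comp (Ext.mk₀ g) _ = 0
      rw [Ext.mk₀_comp_mk₀, h0, Ext.mk₀_zero]
    let e₁ := AddEquiv.ofBijective _ ⟨inj, surj⟩
    let e₂ : Ext (S hm).X₁ (ModuleCat.of k[X] k) 0 ≃+ k :=
      Ext.addEquiv₀.trans (ModuleCat.homAddEquiv.trans freeEquiv)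
    exact ⟨e₁.symm.trans e₂⟩
  · intro n hn
    obtain ⟨m, rfl⟩ := Nat.exists_eq_add_of_le hn
    refine subsingleton_of_forall_eq 0 fun x => ?_
    have hm' : 2 + m = (m + 1) + 1 := by omega
    generalize 2 + m = N at x hm'
    subst hm'
    obtain ⟨y, rfl⟩ := Ext.contravariant_sequence_exact₃ hS _ x
      (Ext.eq_zero_of_projective _) (n₀ := m + 1) (by omega)
    rw [Ext.eq_zero_of_projective y, Ext.comp_zero]
    rfl

end ExtPolyAux

/-- For `k` a field, viewing `k` as a module over `k[Y]` via evaluation at `0`,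
the Ext groups `Ext^0_{k[Y]}(k,k)` and `Ext^1_{k[Y]}(k,k)` are isomorphic to `k`,
and `Ext^n_{k[Y]}(k,k)` vanishes for `n ≥ 2`. -/
theorem ext_polynomial_residue_field (k : Type*) [Field k] :
    letI : Module (Polynomial k) k := Module.compHom k (Polynomial.evalRingHom (0 : k))
    letI : HasDerivedCategory (ModuleCat (Polynomial k)) := HasDerivedCategory.standard _
    haveI : HasExt (ModuleCat (Polynomial k)) := hasExt_of_hasDerivedCategory _
    Nonempty ((Abelian.Ext (ModuleCat.of (Polynomial k) k)
        (ModuleCat.of (Polynomial k) k) 0) ≃+ k) ∧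
    Nonempty ((Abelian.Ext (ModuleCat.of (Polynomial k) k)
        (ModuleCat.of (Polynomial k) k) 1) ≃+ k) ∧
    ∀ n : ℕ, 2 ≤ n → Subsingleton (Abelian.Ext (ModuleCat.of (Polynomial k) k)
        (ModuleCat.of (Polynomial k) k) n) := by
  letI : Module (Polynomial k) k := Module.compHom k (Polynomial.evalRingHom (0 : k))
  letI : HasDerivedCategory (ModuleCat (Polynomial k)) := HasDerivedCategory.standard _
  haveI : HasExt (ModuleCat (Polynomial k)) := hasExt_of_hasDerivedCategory _
  exact ExtPolyAux.main (fun _ _ => rfl)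
end

section
/- Let k be a field, let A = k[X]/(X²), and regard k as an A-module via X ↦ 0. For every n ≥ 0, every nonzero element ξ of Ext^n_A(k, k) and every nonzero element e of Ext^1_A(k, k), the Yoneda composition product of ξ and e in Ext^{n+1}_A(k, k) is nonzero. -/
open CategoryTheory Polynomial

/-- The "exterior algebra on one generator": `A = k[X]/(X²)`. -/
abbrev SquareZeroExt (k : Type*) [Field k] : Type _ :=
  Polynomial k ⧸ Ideal.span {(Polynomial.X : Polynomial k) ^ 2}

/-- The augmentation `k[X]/(X²) → k`, `X ↦ 0`. -/
noncomputable def squareZeroExtAug (k : Type*) [Field k] : SquareZeroExt k →+* k :=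
  Ideal.Quotient.lift _ (Polynomial.evalRingHom 0) (by
    intro a ha
    rw [Ideal.mem_span_singleton] at ha
    obtain ⟨b, rfl⟩ := ha
    simp)

universe w v u

/-- Abstract version: a short exact sequence `0 → K → P → K → 0` with `P` projective. -/
theorem comp_ne_zero_aux {C : Type u} [Category.{v} C] [Abelian C] [HasExt.{w} C]
    {K P : C} (f : K ⟶ P) (g : P ⟶ K) (hz : f ≫ g = 0)
    (hS : (ShortComplex.mk f g hz).ShortExact) [Projective P]
    (hbase : ∀ y : K ⟶ P, y ≫ g = 0)
    (hiso : ∀ φ : K ⟶ K, φ ≠ 0 → IsIso φ)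
    (n : ℕ) (ξ : Abelian.Ext K K n) (e : Abelian.Ext K K 1)
    (hξ : ξ ≠ 0) (he : e ≠ 0) : ξ.comp e rfl ≠ 0 := by
  let δ : Abelian.Ext K K 1 := hS.extClass
  have key : ∀ (n : ℕ) (ξ : Abelian.Ext K K n), ξ.comp δ rfl = 0 → ξ = 0 := by
    intro n
    induction n with
    | zero =>
      intro ξ h
      obtain ⟨y, hy⟩ := Abelian.Ext.covariant_sequence_exact₃ K hS ξ rfl h
      obtain ⟨y', rfl⟩ := (Abelian.Ext.mk₀_bijective _ _).2 y
      rw [← hy]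
      exact (Abelian.Ext.mk₀_comp_mk₀ y' g).trans (by rw [hbase]; simp)
    | succ n ih =>
      intro ξ h
      obtain ⟨ξ', hξ'⟩ := Abelian.Ext.contravariant_sequence_exact₃ hS K ξ
        (Abelian.Ext.eq_zero_of_projective (P := P) _) (n₀ := n) (by omega)
      change δ.comp ξ' _ = ξ at hξ'
      have h2 : δ.comp (ξ'.comp δ rfl) (show 1 + (n + 1) = n + 1 + 1 by omega) = (0 : Abelian.Ext K K (n + 1 + 1)) := by
        rw [← Abelian.Ext.comp_assoc δ ξ' δ (show 1 + n = n + 1 by omega) rfl (by omega), hξ']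
        exact h
      obtain ⟨z, hz'⟩ := Abelian.Ext.contravariant_sequence_exact₁ hS K (ξ'.comp δ rfl)
        (by omega) h2
      have hz0 : z = 0 := Abelian.Ext.eq_zero_of_projective (P := P) z
      rw [hz0, Abelian.Ext.comp_zero] at hz'
      rw [← hξ', ih ξ' hz'.symm, Abelian.Ext.comp_zero]
  obtain ⟨e', he'⟩ := Abelian.Ext.contravariant_sequence_exact₃ hS K e
    (Abelian.Ext.eq_zero_of_projective (P := P) _) (n₀ := 0) (by omega)
  obtain ⟨φ, rfl⟩ := (Abelian.Ext.mk₀_bijective _ _).2 e'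
  change δ.comp (Abelian.Ext.mk₀ φ) _ = e at he'
  have hφ : φ ≠ 0 := by
    rintro rfl
    exact he (by rw [← he']; simp)
  have := hiso φ hφ
  intro h
  apply hξ
  apply key
  have h3 : (ξ.comp δ rfl).comp (Abelian.Ext.mk₀ φ) (add_zero _) = 0 := by
    rw [Abelian.Ext.comp_assoc_of_third_deg_zero, he', h]
  have h4 := congrArg (fun t => t.comp (Abelian.Ext.mk₀ (inv φ)) (add_zero _)) h3
  simpa [Abelian.Ext.comp_assoc_of_third_deg_zero] using h4

section concrete

variable (k : Type*) [Field k]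

theorem sq_smul_def (a : SquareZeroExt k) (c : k) :
    letI : Module (SquareZeroExt k) k := Module.compHom k (squareZeroExtAug k)
    a • c = squareZeroExtAug k a * c := rfl

theorem sq_aug_mk (p : k[X]) :
    squareZeroExtAug k (Ideal.Quotient.mk _ p) = p.coeff 0 := by
  simp [squareZeroExtAug, Polynomial.coeff_zero_eq_eval_zero]

theorem sq_mk_X_mul (q : k[X]) :
    (Ideal.Quotient.mk _ (C (q.coeff 0) * X) : SquareZeroExt k) =
      Ideal.Quotient.mk _ (q * X) := by
  rw [Ideal.Quotient.eq, Ideal.mem_span_singleton]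
  obtain ⟨r, hr⟩ : X ∣ C (q.coeff 0) - q := by
    rw [Polynomial.X_dvd_iff]; simp
  exact ⟨r, by rw [← sub_mul, hr]; ring⟩

theorem sq_mk_CX_eq_zero (c : k)
    (h : (Ideal.Quotient.mk _ (C c * X) : SquareZeroExt k) = 0) : c = 0 := by
  rw [Ideal.Quotient.eq_zero_iff_mem, Ideal.mem_span_singleton,
    Polynomial.X_pow_dvd_iff] at h
  simpa using h 1 (by norm_num)

theorem sq_aug_eq_zero (a : SquareZeroExt k) (h : squareZeroExtAug k a = 0) :
    ∃ q : k[X], a = Ideal.Quotient.mk _ (q * X) := by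
  obtain ⟨p, rfl⟩ := Ideal.Quotient.mk_surjective a
  rw [sq_aug_mk, ← Polynomial.X_dvd_iff] at h
  obtain ⟨q, rfl⟩ := h
  exact ⟨q, by rw [mul_comm]⟩

/-- The inclusion `k → A`, `c ↦ cX`. -/
noncomputable def sqF :
    letI : Module (SquareZeroExt k) k := Module.compHom k (squareZeroExtAug k)
    k →ₗ[SquareZeroExt k] SquareZeroExt k :=
  letI : Module (SquareZeroExt k) k := Module.compHom k (squareZeroExtAug k)
  { toFun := fun c => Ideal.Quotient.mk _ (C c * X)
    map_add' := fun a b => by rw [← map_add]; congr 1; rw [C_add]; ring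
    map_smul' := fun a c => by
      obtain ⟨p, rfl⟩ := Ideal.Quotient.mk_surjective a
      have := sq_mk_X_mul k (p * C c)
      rw [sq_smul_def, sq_aug_mk]
      rw [Polynomial.mul_coeff_zero, Polynomial.coeff_C_zero] at this
      rw [this, RingHom.id_apply, smul_eq_mul, ← map_mul, mul_assoc] }

/-- The augmentation as a linear map. -/
noncomputable def sqG :
    letI : Module (SquareZeroExt k) k := Module.compHom k (squareZeroExtAug k)
    SquareZeroExt k →ₗ[SquareZeroExt k] k :=
  letI : Module (SquareZeroExt k) k := Module.compHom k (squareZeroExtAug k)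
  { toFun := squareZeroExtAug k
    map_add' := map_add _
    map_smul' := fun a b => map_mul _ a b }

end concrete

/-- For `k` a field and `A = k[X]/(X²)`, with `k` an `A`-module via `X ↦ 0`, the Yoneda
composition product of any nonzero class in `Ext^n_A(k,k)` with any nonzero class in
`Ext^1_A(k,k)` is nonzero in `Ext^{n+1}_A(k,k)`: the Ext algebra is polynomial on one
generator. -/
theorem ext_squareZeroExt_comp_ne_zero (k : Type*) [Field k] :
    letI : Module (SquareZeroExt k) k := Module.compHom k (squareZeroExtAug k)
    letI : HasDerivedCategory (ModuleCat (SquareZeroExt k)) := HasDerivedCategory.standard _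
    haveI : HasExt (ModuleCat (SquareZeroExt k)) := hasExt_of_hasDerivedCategory _
    ∀ (n : ℕ)
      (ξ : Abelian.Ext (ModuleCat.of (SquareZeroExt k) k) (ModuleCat.of (SquareZeroExt k) k) n)
      (e : Abelian.Ext (ModuleCat.of (SquareZeroExt k) k) (ModuleCat.of (SquareZeroExt k) k) 1),
      ξ ≠ 0 → e ≠ 0 → ξ.comp e rfl ≠ 0 := by
  letI : Module (SquareZeroExt k) k := Module.compHom k (squareZeroExtAug k)
  letI : HasDerivedCategory (ModuleCat (SquareZeroExt k)) := HasDerivedCategory.standard _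
  haveI : HasExt (ModuleCat (SquareZeroExt k)) := hasExt_of_hasDerivedCategory _
  intro n ξ e hξ he
  let A := SquareZeroExt k
  have hz : ModuleCat.ofHom (sqF k) ≫ ModuleCat.ofHom (sqG k) = 0 := by
    ext : 1
    refine LinearMap.ext fun c => ?_
    change squareZeroExtAug k (Ideal.Quotient.mk _ (C c * X)) = 0
    rw [sq_aug_mk]; simp
  have hinj : Function.Injective (sqF k) := by
    rw [injective_iff_map_eq_zero]
    exact fun c hc => sq_mk_CX_eq_zero k c hc
  have hsurj : Function.Surjective (sqG k) := fun c =>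
    ⟨Ideal.Quotient.mk _ (C c), (sq_aug_mk k _).trans (by simp)⟩
  haveI : Projective (ModuleCat.of A A) :=
    (IsProjective.iff_projective (R := A) A).1 inferInstance
  refine comp_ne_zero_aux (ModuleCat.ofHom (sqF k)) (ModuleCat.ofHom (sqG k)) hz ?_ ?_ ?_ n ξ e hξ he
  · refine { exact := ?_, mono_f := ?_, epi_g := ?_ }
    · rw [ShortComplex.moduleCat_exact_iff]
      intro a ha
      obtain ⟨q, rfl⟩ := sq_aug_eq_zero k a ha
      exact ⟨q.coeff 0, sq_mk_X_mul k q⟩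
    · exact (ModuleCat.mono_iff_injective _).2 hinj
    · exact (ModuleCat.epi_iff_surjective _).2 hsurj
  · intro y
    ext : 1
    refine LinearMap.ext fun c => ?_
    change squareZeroExtAug k (y.hom c) = 0
    obtain ⟨p, hp⟩ := Ideal.Quotient.mk_surjective (y.hom c)
    have h1 : (Ideal.Quotient.mk _ X : A) • y.hom c = 0 := by
      rw [← map_smul, sq_smul_def, sq_aug_mk]; simp
    rw [← hp, smul_eq_mul, ← map_mul, mul_comm, ← sq_mk_X_mul] at h1
    rw [← hp, sq_aug_mk]
    exact sq_mk_CX_eq_zero k _ h1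
  · intro φ hφ
    have hlin : ∀ c : k, φ.hom c = c * φ.hom (1 : k) := by
      intro c
      have := φ.hom.map_smul (Ideal.Quotient.mk _ (C c) : A) (1 : k)
      rw [sq_smul_def, sq_smul_def, sq_aug_mk] at this
      simpa using this
    have h1 : (φ.hom (1 : k) : k) ≠ 0 := by
      intro h
      apply hφ
      ext : 1
      refine LinearMap.ext fun c => ?_
      rw [hlin, h]; exact mul_zero _
    rw [ConcreteCategory.isIso_iff_bijective]
    constructor
    · intro a b hab
      change φ.hom a = φ.hom b at hab
      rw [hlin a, hlin b] at hab
      exact mul_right_cancel₀ h1 hab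
    · intro c
      exact ⟨(c / φ.hom (1 : k) : k), (hlin _).trans (div_mul_cancel₀ _ h1)⟩
end

section
/- Let R be a commutative ring and M a finitely generated projective R-module on which R acts faithfully. Let A = End_R(M), acting on M by evaluation. Then the canonical ring homomorphism R → End_A(M), sending r to the A-linear endomorphism m ↦ r • m, is bijective. -/
/-- The canonical ring homomorphism `R → End_{End_R(M)}(M)` sending `r` to the
(`End_R(M)`-linear) endomorphism `m ↦ r • m`. -/
def centralActionHom (R M : Type*) [CommRing R] [AddCommGroup M] [Module R M] :
    R →+* Module.End (Module.End R M) M where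
  toFun r :=
    { toFun := fun m => r • m
      map_add' := fun m n => smul_add r m n
      map_smul' := fun f m => (f.map_smul r m).symm }
  map_one' := by ext m; simp
  map_mul' r s := by ext m; simp [mul_smul, smul_comm r s m]
  map_zero' := by ext m; simp
  map_add' r s := by ext m; simp [add_smul]

/-- Double centralizer: for a finitely generated projective faithful module `M` over a
commutative ring `R`, the canonical map `R → End_{End_R(M)}(M)`, `r ↦ (m ↦ r • m)`, is
bijective. -/
theorem bijective_centralActionHom (R M : Type*) [CommRing R] [AddCommGroup M] [Module R M]
    [Module.Finite R M] [Module.Projective R M] [FaithfulSMul R M] :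
    Function.Bijective (centralActionHom R M) := by
  have key : (1 : R) ∈ Ideal.span {r : R | ∃ (f : M →ₗ[R] R) (m : M), f m = r} := by
    obtain ⟨s, hs⟩ := Module.projective_def'.1 (inferInstance : Module.Projective R M)
    obtain ⟨r, hr, h⟩ := Submodule.exists_sub_one_mem_and_smul_eq_zero_of_fg_of_le_smul
      (Ideal.span {r : R | ∃ (f : M →ₗ[R] R) (m : M), f m = r}) (⊤ : Submodule R M)
      Module.Finite.fg_top (by
        intro m _
        have hm : Finsupp.linearCombination R id (s m) = m := LinearMap.congr_fun hs m
        rw [← hm, Finsupp.linearCombination_apply, Finsupp.sum]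
        refine Submodule.sum_mem _ fun p _ => ?_
        refine Submodule.smul_mem_smul (Ideal.subset_span ?_) trivial
        exact ⟨Finsupp.lapply p ∘ₗ s, m, rfl⟩)
    have h0 : r = 0 := FaithfulSMul.eq_of_smul_eq_smul (α := M) fun m => by
      rw [h m trivial, zero_smul]
    subst h0
    simpa using neg_mem hr
  constructor
  · intro a b hab
    exact FaithfulSMul.eq_of_smul_eq_smul (α := M) fun m => LinearMap.congr_fun hab m
  · intro g
    have main : ∀ r ∈ Ideal.span {r : R | ∃ (f : M →ₗ[R] R) (m : M), f m = r},
        ∃ t : R, ∀ n : M, g (r • n) = t • n := by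
      intro r hr
      induction hr using Submodule.span_induction with
      | mem r hr =>
        obtain ⟨f, m, rfl⟩ := hr
        exact ⟨f (g m), fun n => g.map_smul (f.smulRight n : Module.End R M) m⟩
      | zero => exact ⟨0, fun n => by simp⟩
      | add x y _ _ hx hy =>
        obtain ⟨a, ha⟩ := hx
        obtain ⟨b, hb⟩ := hy
        exact ⟨a + b, fun n => by rw [add_smul, map_add, ha, hb, add_smul]⟩
      | smul c x _ hx =>
        obtain ⟨a, ha⟩ := hx
        exact ⟨a * c, fun n => by rw [smul_eq_mul, mul_comm, mul_smul, ha, mul_smul]⟩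
    obtain ⟨t, ht⟩ := main 1 key
    refine ⟨t, LinearMap.ext fun n => ?_⟩
    have := ht n
    rw [one_smul] at this
    exact this.symm
end
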